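/- arXiv:2204.07219 — 2 statements merged into one kernel-verified Lean document; each statement's English description precedes it below -/
import Mathlib

section
/- Let G = (U, V, E) be a bipartite graph with |U| = |V| = n, and let k be a natural number with n ≥ k > n/2. Then the number of pairs (u, v) ∈ U × V with |deg(u) − deg(v)| ≥ k is at most 2k(n−k). -/
open Finset

/-- Double counting of the pairs in `S ×ˢ D`: each is an edge, counted by the degree of its left
end, or a non-edge, counted by the codegree of its right end. -/
lemma card_mul_card_le_sum_deg_add_sum_codeg {n : ℕ} (E : Fin n → Fin n → Bool)
    (S D : Finset (Fin n)) :
    (#S * #D : ℤ) ≤ ∑ i ∈ S, (#{j | E i j} : ℤ) + ∑ j ∈ D, ((n : ℤ) - #{i | E i j}) := by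
  have hcodeg : ∀ j, ((n : ℤ) - #{i | E i j}) = #{i | ¬ E i j} := by
    intro j
    have h := card_filter_add_card_filter_not (s := (univ : Finset (Fin n))) (fun i => E i j = true)
    rw [card_univ, Fintype.card_fin] at h
    push_cast [← h]
    ring
  have hedge : ∀ i, ∑ j ∈ D, (if E i j then (1 : ℤ) else 0) ≤ #{j | E i j} := by
    intro i
    rw [sum_boole]
    exact_mod_cast card_le_card (filter_subset_filter _ (subset_univ D))
  have hnon : ∀ j, ∑ i ∈ S, (if ¬ E i j then (1 : ℤ) else 0) ≤ #{i | ¬ E i j} := by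
    intro j
    rw [sum_boole]
    exact_mod_cast card_le_card (filter_subset_filter _ (subset_univ S))
  calc (#S * #D : ℤ)
      = ∑ i ∈ S, ∑ j ∈ D, ((if E i j then (1 : ℤ) else 0) + if ¬ E i j then (1 : ℤ) else 0) := by
        have : ∀ i j, ((if E i j then (1 : ℤ) else 0) + if ¬ E i j then (1 : ℤ) else 0) = 1 := by
          intro i j
          by_cases h : E i j <;> simp [h]
        simp only [this]
        simp
    _ = ∑ i ∈ S, ∑ j ∈ D, (if E i j then (1 : ℤ) else 0)
        + ∑ j ∈ D, ∑ i ∈ S, (if ¬ E i j then (1 : ℤ) else 0) := by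
        simp only [sum_add_distrib]
        rw [sum_comm (s := D)]
    _ ≤ _ := by
        simp only [hcodeg]
        exact add_le_add (sum_le_sum fun i _ => hedge i) (sum_le_sum fun j _ => hnon j)

/-- The pairs whose right degree exceeds the left degree by at least `k` lie in a rectangle `s × d`,
and there are at most `m * max s d` of them, where `m + k` is the size of each part. -/
lemma card_deg_add_le_deg {n k m : ℕ} (hn : m + k = n) (E : Fin n → Fin n → Bool)
    (a b : Fin n → ℕ) (ha : ∀ i, a i = #{j | E i j}) (hb : ∀ j, b j = #{i | E i j}) :
    #{p : Fin n × Fin n | a p.1 + k ≤ b p.2} ≤ #{i | a i ≤ m} * #{j | k ≤ b j} ∧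
    #{p : Fin n × Fin n | a p.1 + k ≤ b p.2} ≤ m * max #{i | a i ≤ m} #{j | k ≤ b j} := by
  have hbn : ∀ j, b j ≤ n := fun j => by
    rw [hb]
    exact (card_le_univ _).trans_eq (Fintype.card_fin n)
  set S : Finset (Fin n) := {i | a i ≤ m} with hS
  set D : Finset (Fin n) := {j | k ≤ b j} with hD
  set B : Finset (Fin n × Fin n) := {p | a p.1 + k ≤ b p.2} with hB
  have hsub : B ⊆ S ×ˢ D := by
    intro p hp
    have := hbn p.2
    simp only [hB, hS, hD, mem_filter, mem_univ, true_and, mem_product] at hp ⊢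
    omega
  have hrect : #B ≤ #S * #D := (card_le_card hsub).trans_eq (card_product S D)
  refine ⟨hrect, ?_⟩
  have hcount := card_mul_card_le_sum_deg_add_sum_codeg E S D
  simp only [← ha, ← hb] at hcount
  have hx : ∀ i ∈ S, (0 : ℤ) ≤ m - a i := fun i hi => by
    simp only [hS, mem_filter] at hi
    omega
  have hy : ∀ j ∈ D, (0 : ℤ) ≤ b j - k := fun j hj => by
    simp only [hD, mem_filter] at hj
    omega
  have hX := sum_nonneg hx
  have hY := sum_nonneg hy
  set X : ℤ := ∑ i ∈ S, ((m : ℤ) - a i) with hXdef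
  set Y : ℤ := ∑ j ∈ D, ((b j : ℤ) - k) with hYdef
  have hslack : X + Y ≤ m * (#S + #D) - #S * #D := by
    simp only [hXdef, hYdef, sum_sub_distrib, sum_const, nsmul_eq_mul] at hcount ⊢
    have : (n : ℤ) = m + k := by exact_mod_cast hn.symm
    rw [this] at hcount
    linarith
  have hweight : (m * #B : ℤ) ≤ #D * X + #S * Y := by
    calc (m * #B : ℤ) = ∑ p ∈ B, (m : ℤ) := by simp [mul_comm]
      _ ≤ ∑ p ∈ B, (((m : ℤ) - a p.1) + (b p.2 - k)) := by
        refine sum_le_sum fun p hp => ?_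
        simp only [hB, mem_filter] at hp
        omega
      _ ≤ ∑ p ∈ S ×ˢ D, (((m : ℤ) - a p.1) + (b p.2 - k)) := by
        refine sum_le_sum_of_subset_of_nonneg hsub fun p hp _ => ?_
        rw [mem_product] at hp
        exact add_nonneg (hx _ hp.1) (hy _ hp.2)
      _ = #D * X + #S * Y := by
        rw [sum_product]
        simp only [sum_add_distrib, sum_const, nsmul_eq_mul, hXdef, hYdef, mul_sum]
  rcases le_total #S m with hs | hs
  · exact hrect.trans (Nat.mul_le_mul hs (le_max_right _ _))
  rcases le_total #D m with hd | hd
  · rw [mul_comm] at hrect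
    exact hrect.trans (Nat.mul_le_mul hd (le_max_left _ _))
  rcases Nat.eq_zero_or_pos m with rfl | hm
  · have : #S * #D ≤ 0 := by
      have : (#S * #D : ℤ) ≤ 0 := by push_cast at hslack; linarith
      exact_mod_cast this
    omega
  · obtain ⟨M, hM⟩ : ∃ M, M = max #S #D := ⟨_, rfl⟩
    rw [← hM]
    have hsM : (#S : ℤ) ≤ M := by exact_mod_cast hM ▸ le_max_left _ _
    have hdM : (#D : ℤ) ≤ M := by exact_mod_cast hM ▸ le_max_right _ _
    have hXY : X + Y ≤ m * m := by
      have hs' : (0 : ℤ) ≤ #S - m := by omega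
      have hd' : (0 : ℤ) ≤ #D - m := by omega
      nlinarith [mul_nonneg hs' hd']
    have h1 := mul_le_mul_of_nonneg_right hdM hX
    have h2 := mul_le_mul_of_nonneg_right hsM hY
    have h3 := mul_le_mul_of_nonneg_left hXY (Int.natCast_nonneg M)
    have h4 : (m * #B : ℤ) ≤ m * (m * M) := by linarith
    exact_mod_cast le_of_mul_le_mul_left h4 (by exact_mod_cast hm)

lemma add_le_of_crossing_bounds {m k r s c d A B : ℤ} (hm : 0 ≤ m) (hmk : m < k)
    (hr : 0 ≤ r) (hd : 0 ≤ d)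
    (hrs : r + s ≤ m + k) (hcd : c + d ≤ m + k)
    (hA : A ≤ r * c) (hB : B ≤ s * d) (hA' : A ≤ m * c) (hB' : B ≤ m * s) :
    A + B ≤ 2 * k * m := by
  rcases le_total r m with h1 | h1 <;> rcases le_total d m with h2 | h2
  · have e1 : r * c ≤ r * (m + k - d) := mul_le_mul_of_nonneg_left (by linarith) hr
    have e2 : s * d ≤ (m + k - r) * d := mul_le_mul_of_nonneg_right (by linarith) hd
    have e3 : 0 ≤ (m - r) * (m + k - 2 * d) := mul_nonneg (by linarith) (by linarith)
    have e4 : 0 ≤ (m - d) * (k - m) := mul_nonneg (by linarith) (by linarith)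
    nlinarith
  · rcases le_total c m with h3 | h3
    · have e1 : r * c ≤ r * m := mul_le_mul_of_nonneg_left h3 hr
      nlinarith
    · have e1 : 0 ≤ (m - r) * (c - m) := mul_nonneg (by linarith) (by linarith)
      nlinarith
  · rcases le_total s m with h3 | h3
    · have e1 : s * d ≤ m * d := mul_le_mul_of_nonneg_right h3 hd
      nlinarith
    · have e1 : 0 ≤ (m - d) * (s - m) := mul_nonneg (by linarith) (by linarith)
      nlinarith
  · nlinarith

theorem degree_difference_bound (n k : ℕ) (hkn : k ≤ n) (hk : n < 2 * k)
    (E : Fin n → Fin n → Bool)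
    (degU : Fin n → ℕ) (degV : Fin n → ℕ)
    (hdegU : ∀ i, degU i = (univ.filter (fun j => E i j)).card)
    (hdegV : ∀ j, degV j = (univ.filter (fun i => E i j)).card) :
    ((univ : Finset (Fin n × Fin n)).filter
      (fun p => (k : ℤ) ≤ |(degU p.1 : ℤ) - (degV p.2 : ℤ)|)).card ≤ 2 * k * (n - k) := by
  obtain ⟨m, hmn⟩ : ∃ m, n - k = m := ⟨_, rfl⟩
  rw [hmn]
  have hn : m + k = n := by omega
  obtain ⟨hB, hB'⟩ := card_deg_add_le_deg hn E degU degV hdegU hdegV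
  obtain ⟨hA, hA'⟩ := card_deg_add_le_deg hn (fun j i => E i j) degV degU hdegV hdegU
  have hswap : #{p : Fin n × Fin n | degV p.2 + k ≤ degU p.1}
      = #{p : Fin n × Fin n | degV p.1 + k ≤ degU p.2} :=
    card_equiv (Equiv.prodComm _ _) (by simp)
  have hsplit : #{p : Fin n × Fin n | (k : ℤ) ≤ |(degU p.1 : ℤ) - (degV p.2 : ℤ)|}
      ≤ #{p : Fin n × Fin n | degV p.1 + k ≤ degU p.2}
        + #{p : Fin n × Fin n | degU p.1 + k ≤ degV p.2} := by
    rw [← hswap]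
    refine (card_le_card fun p hp => ?_).trans (card_union_le _ _)
    simp only [mem_union, mem_filter, mem_univ, true_and, le_abs] at hp ⊢
    omega
  have hdisj : ∀ f : Fin n → ℕ, #{i | k ≤ f i} + #{i | f i ≤ m} ≤ m + k := by
    intro f
    rw [← card_union_of_disjoint, hn]
    · exact (card_le_univ _).trans_eq (Fintype.card_fin n)
    · refine disjoint_filter.2 fun i _ h => ?_
      omega
  have hrs := hdisj degU
  have hcd := hdisj degV
  refine hsplit.trans ?_
  generalize #{p : Fin n × Fin n | degV p.1 + k ≤ degU p.2} = A at *
  generalize #{p : Fin n × Fin n | degU p.1 + k ≤ degV p.2} = B at *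
  generalize #{i | k ≤ degU i} = r at *
  generalize #{i | degU i ≤ m} = s at *
  generalize #{j | k ≤ degV j} = d at *
  generalize #{j | degV j ≤ m} = c at *
  have hmk : m < k := by omega
  rw [mul_comm] at hA
  clear hsplit hswap hdisj
  zify at *
  have hm : (0 : ℤ) ≤ m := by positivity
  rcases max_choice (c : ℤ) r with h1 | h1 <;> rcases max_choice (s : ℤ) d with h2 | h2 <;>
    rw [h1] at hA' <;> rw [h2] at hB'
  · exact add_le_of_crossing_bounds hm hmk (by positivity)
      (by positivity) hrs (by linarith) hA hB hA' hB'
  · nlinarith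
  · nlinarith
  · rw [add_comm (A : ℤ)]
    exact add_le_of_crossing_bounds hm hmk (by positivity)
      (by positivity) (by linarith) hcd hB hA hB' hA'
end

section
/- Let δ ∈ (1/2, 1]. For each n, let k_n = ⌈nδ − C n^{3/4}⌉ for a fixed constant C ≥ 0, and suppose G_n = (U_n, V_n, E_n) are bipartite graphs with |U_n| = |V_n| = n. Then limsup_{n→∞} (1/n²) · #{(i,j) : |deg(u_i^{(n)}) − deg(v_j^{(n)})| ≥ nδ − 2C n^{3/4}} ≤ 2δ(1 − δ). -/
open Finset Filter

section BipartiteDegrees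

variable {α β : Type*} [Fintype α] [Fintype β]

/-- The edges leaving `A` are at most all pairs leaving `B`, plus the edges between `A` and `B`. -/
lemma exists_edge_count_bound (E : α → β → Bool) (A : Finset α) (B : Finset β) :
    ∃ e : ℝ, 0 ≤ e ∧ (∑ i ∈ A, (#{j | E i j} : ℝ)) ≤ #A * ((Fintype.card β : ℝ) - #B) + e ∧
      e ≤ ∑ j ∈ B, (#{i | E i j} : ℝ) ∧ e ≤ (#A : ℝ) * #B := by
  classical
  refine ⟨∑ i ∈ A, (#{j ∈ B | E i j} : ℝ), by positivity, ?_, ?_, ?_⟩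
  · rw [← nsmul_eq_mul, ← Finset.sum_const, ← Finset.sum_add_distrib]
    refine Finset.sum_le_sum fun i _ => ?_
    have hsub : ({j | E i j} : Finset β) ⊆ Bᶜ ∪ {j ∈ B | E i j} := by
      intro j hj
      by_cases hB : j ∈ B <;> simp_all
    have hcard := (Finset.card_le_card hsub).trans (Finset.card_union_le _ _)
    have hB := Finset.card_add_card_compl B
    have h1 : (#{j | E i j} : ℝ) ≤ #Bᶜ + #{j ∈ B | E i j} := by exact_mod_cast hcard
    have h2 : (#B : ℝ) + #Bᶜ = Fintype.card β := by exact_mod_cast hB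
    linarith
  · have h := Finset.sum_card_bipartiteAbove_eq_sum_card_bipartiteBelow
      (s := A) (t := B) (fun i j => E i j = true)
    simp only [Finset.bipartiteAbove, Finset.bipartiteBelow] at h
    have h' : (∑ i ∈ A, (#{j ∈ B | E i j} : ℝ)) = ∑ j ∈ B, (#{i ∈ A | E i j} : ℝ) := by
      exact_mod_cast h
    rw [h']
    refine Finset.sum_le_sum fun j _ => ?_
    exact_mod_cast Finset.card_le_card (Finset.filter_subset_filter _ (Finset.subset_univ A))
  · rw [← nsmul_eq_mul, ← Finset.sum_const]
    refine Finset.sum_le_sum fun i _ => ?_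
    exact_mod_cast Finset.card_filter_le _ _

lemma card_le_or_card_le_of_forall_degree_add_le (E : α → β → Bool) (k : ℝ)
    (A : Finset α) (B : Finset β)
    (h : ∀ i ∈ A, ∀ j ∈ B, (#{i | E i j} : ℝ) + k ≤ #{j | E i j})
    (hA : A.Nonempty) (hB : B.Nonempty) :
    (#A : ℝ) ≤ Fintype.card β - k ∨ (#B : ℝ) ≤ Fintype.card β - k := by
  obtain ⟨e, h0, h1, h2, h3⟩ := exists_edge_count_bound E A B
  have hp : (0 : ℝ) < #A := by exact_mod_cast hA.card_pos
  have hq : (0 : ℝ) < #B := by exact_mod_cast hB.card_pos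
  have hsum : ∑ i ∈ A, ∑ j ∈ B, ((#{i | E i j} : ℝ) + k) ≤
      ∑ i ∈ A, ∑ _j ∈ B, (#{j | E i j} : ℝ) :=
    Finset.sum_le_sum fun i hi => Finset.sum_le_sum fun j hj => h i hi j hj
  simp only [Finset.sum_add_distrib, Finset.sum_const, nsmul_eq_mul, ← Finset.mul_sum] at hsum
  generalize (∑ i ∈ A, (#{j | E i j} : ℝ)) = X at *
  generalize (∑ j ∈ B, (#{i | E i j} : ℝ)) = Y at *
  generalize (#A : ℝ) = p at *
  generalize (#B : ℝ) = q at *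
  have h4 : p * q * k ≤ p * q * (Fintype.card β - q) + (q - p) * e := by
    nlinarith [mul_le_mul_of_nonneg_left h1 hq.le, mul_le_mul_of_nonneg_left h2 hp.le]
  rcases le_total p q with hpq | hpq
  · left
    have h5 : p * q * p ≤ p * q * (Fintype.card β - k) := by
      nlinarith [mul_le_mul_of_nonneg_left h3 (sub_nonneg.2 hpq)]
    exact le_of_mul_le_mul_left h5 (mul_pos hp hq)
  · right
    have h5 : p * q * q ≤ p * q * (Fintype.card β - k) := by
      nlinarith [mul_nonneg (sub_nonneg.2 hpq) h0]
    exact le_of_mul_le_mul_left h5 (mul_pos hp hq)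

/-- The pairs whose degrees differ by at least `k` form a staircase that fits in an `L`-shape. -/
lemma card_degree_add_le_le_of_le_card (E : α → β → Bool) (k : ℝ)
    (hk : k ≤ Fintype.card β)
    (hd : (Fintype.card β : ℝ) - k ≤ #{j | (#{i | E i j} : ℝ) ≤ Fintype.card β - k}) :
    (#{p : α × β | (#{i | E i p.2} : ℝ) + k ≤ #{j | E p.1 j}} : ℝ) ≤
      (Fintype.card β - k) * (#{i | k ≤ (#{j | E i j} : ℝ)} +
        #{j | (#{i | E i j} : ℝ) ≤ Fintype.card β - k} - (Fintype.card β - k)) := by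
  classical
  set m : ℝ := Fintype.card β - k with hm
  have hm0 : 0 ≤ m := sub_nonneg.2 hk
  set H : Finset α := {i | k ≤ (#{j | E i j} : ℝ)} with hH
  set L : Finset β := {j | (#{i | E i j} : ℝ) ≤ m} with hL
  let N : α → Finset β := fun i => {j | (#{i | E i j} : ℝ) + k ≤ #{j | E i j}}
  have hNL : ∀ i, #(N i) ≤ #L := by
    intro i
    refine Finset.card_le_card fun j hj => ?_
    simp only [N, hL, Finset.mem_filter, Finset.mem_univ, true_and] at hj ⊢
    have : (#{j | E i j} : ℝ) ≤ Fintype.card β := by exact_mod_cast Finset.card_le_univ _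
    linarith
  have hNH : ∀ i, (N i).Nonempty → i ∈ H := by
    rintro i ⟨j, hj⟩
    simp only [N, hH, Finset.mem_filter, Finset.mem_univ, true_and] at hj ⊢
    have : (0 : ℝ) ≤ #{i | E i j} := by positivity
    linarith
  have hcount : (#{p : α × β | (#{i | E i p.2} : ℝ) + k ≤ #{j | E p.1 j}} : ℝ) =
      ∑ i ∈ H, (#(N i) : ℝ) := by
    rw [Finset.sum_subset (Finset.subset_univ H)]
    · rw [← Nat.cast_sum, Nat.cast_inj, Finset.card_filter, Fintype.sum_prod_type]
      exact Finset.sum_congr rfl fun i _ => (Finset.card_filter _ _).symm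
    · intro i _ hi
      have : ¬ (N i).Nonempty := fun h => hi (hNH i h)
      simpa [Finset.not_nonempty_iff_eq_empty] using this
  set R : Finset α := {i ∈ H | m < #(N i)} with hR
  have hRm : (#R : ℝ) ≤ m := by
    rcases R.eq_empty_or_nonempty with hRe | hRn
    · simpa [hRe] using hm0
    obtain ⟨i₀, hi₀, hmin⟩ := R.exists_min_image (fun i => (#{j | E i j} : ℝ)) hRn
    have hi₀' : m < #(N i₀) := (Finset.mem_filter.1 hi₀).2
    have hNn : (N i₀).Nonempty := by
      rw [← Finset.card_pos]
      exact_mod_cast hm0.trans_lt hi₀'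
    refine (card_le_or_card_le_of_forall_degree_add_le E k R (N i₀) ?_ hRn hNn).resolve_right
      (not_le.2 hi₀')
    intro i hi j hj
    exact (Finset.mem_filter.1 hj).2.trans (hmin i hi)
  have hsum : ∑ i ∈ H, (#(N i) : ℝ) ≤ ∑ i ∈ H, (m + if m < #(N i) then (#L : ℝ) - m else 0) := by
    refine Finset.sum_le_sum fun i _ => ?_
    have : (#(N i) : ℝ) ≤ #L := by exact_mod_cast hNL i
    split_ifs with h
    · linarith
    · linarith
  rw [Finset.sum_add_distrib, ← Finset.sum_filter, Finset.sum_const, Finset.sum_const,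
    nsmul_eq_mul, nsmul_eq_mul, ← hR] at hsum
  rw [hcount]
  nlinarith [mul_le_mul_of_nonneg_right hRm (sub_nonneg.2 hd)]

lemma filter_degree_add_le_subset_product (E : α → β → Bool) (k : ℝ) :
    ({p : α × β | (#{i | E i p.2} : ℝ) + k ≤ #{j | E p.1 j}} : Finset (α × β)) ⊆
      ({i | k ≤ (#{j | E i j} : ℝ)} : Finset α) ×ˢ
        ({j | (#{i | E i j} : ℝ) ≤ Fintype.card β - k} : Finset β) := by
  rintro ⟨i, j⟩ hp
  simp only [Finset.mem_filter, Finset.mem_univ, true_and, Finset.mem_product] at hp ⊢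
  have h1 : (#{j | E i j} : ℝ) ≤ Fintype.card β := by exact_mod_cast Finset.card_le_univ _
  have h2 : (0 : ℝ) ≤ #{i | E i j} := by positivity
  constructor <;> linarith

lemma card_degree_add_le_le_mul (E : α → β → Bool) (k : ℝ) :
    (#{p : α × β | (#{i | E i p.2} : ℝ) + k ≤ #{j | E p.1 j}} : ℝ) ≤
      #{i | k ≤ (#{j | E i j} : ℝ)} * #{j | (#{i | E i j} : ℝ) ≤ Fintype.card β - k} := by
  have h := Finset.card_le_card (filter_degree_add_le_subset_product E k)
  rw [Finset.card_product] at h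
  exact_mod_cast h

/-- A Markov-type bound on the number of pairs whose degrees differ by at least `k`. -/
lemma mul_card_degree_add_le_le (E : α → β → Bool) (k : ℝ) :
    (Fintype.card β - k) * (#{p : α × β | (#{i | E i p.2} : ℝ) + k ≤ #{j | E p.1 j}} : ℝ) ≤
      max (#{i | k ≤ (#{j | E i j} : ℝ)} : ℝ) #{j | (#{i | E i j} : ℝ) ≤ Fintype.card β - k} *
      ((Fintype.card β - k) ^ 2 - (#{i | k ≤ (#{j | E i j} : ℝ)} - (Fintype.card β - k)) *
        (#{j | (#{i | E i j} : ℝ) ≤ Fintype.card β - k} - (Fintype.card β - k))) := by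
  classical
  have hsub := filter_degree_add_le_subset_product E k
  set m : ℝ := Fintype.card β - k with hm
  set H : Finset α := {i | k ≤ (#{j | E i j} : ℝ)} with hH
  set L : Finset β := {j | (#{i | E i j} : ℝ) ≤ m} with hL
  set P : Finset (α × β) := {p | (#{i | E i p.2} : ℝ) + k ≤ #{j | E p.1 j}} with hP
  have hHk : ∀ i ∈ H, 0 ≤ (#{j | E i j} : ℝ) - k := fun i hi =>
    sub_nonneg.2 (Finset.mem_filter.1 hi).2
  have hLm : ∀ j ∈ L, 0 ≤ m - (#{i | E i j} : ℝ) := fun j hj =>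
    sub_nonneg.2 (Finset.mem_filter.1 hj).2
  have h1 : m * #P ≤ ∑ p ∈ H ×ˢ L, (((#{j | E p.1 j} : ℝ) - k) + (m - #{i | E i p.2})) := by
    calc m * #P = ∑ _p ∈ P, m := by rw [Finset.sum_const, nsmul_eq_mul, mul_comm]
      _ ≤ ∑ p ∈ P, (((#{j | E p.1 j} : ℝ) - k) + (m - #{i | E i p.2})) := by
        refine Finset.sum_le_sum fun p hp => ?_
        have := (Finset.mem_filter.1 hp).2
        linarith
      _ ≤ _ := by
        refine Finset.sum_le_sum_of_subset_of_nonneg hsub fun p hp _ => ?_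
        rw [Finset.mem_product] at hp
        exact add_nonneg (hHk _ hp.1) (hLm _ hp.2)
  rw [Finset.sum_product] at h1
  simp only [Finset.sum_add_distrib, Finset.sum_const, nsmul_eq_mul, ← Finset.mul_sum] at h1
  have hX := Finset.sum_nonneg hHk
  have hY := Finset.sum_nonneg hLm
  obtain ⟨e, -, h2, h3, -⟩ := exists_edge_count_bound E H L
  have hXY : ∑ i ∈ H, ((#{j | E i j} : ℝ) - k) + ∑ j ∈ L, (m - (#{i | E i j} : ℝ)) ≤
      m ^ 2 - (#H - m) * (#L - m) := by
    simp only [Finset.sum_sub_distrib, Finset.sum_const, nsmul_eq_mul]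
    have : (Fintype.card β : ℝ) = m + k := by rw [hm]; ring
    rw [this] at h2
    linarith
  have hmax : (0 : ℝ) ≤ max (#H : ℝ) #L := le_max_of_le_left (by positivity)
  nlinarith [mul_le_mul_of_nonneg_left hXY hmax,
    mul_le_mul_of_nonneg_right (le_max_left (#H : ℝ) #L) hY,
    mul_le_mul_of_nonneg_right (le_max_right (#H : ℝ) #L) hX]

end BipartiteDegrees

/-- The case of `add_le_two_mul_mul_of_staircase_bounds` in which the first staircase is large. -/
lemma add_le_two_mul_mul_of_markov_bound {m k a b c d P Q : ℝ} (hm : 0 ≤ m) (hmk : m < k)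
    (hb : 0 ≤ b) (hc : 0 ≤ c) (hab : a + b ≤ m + k) (hcd : c + d ≤ m + k)
    (hak : k ≤ a) (hdk : k ≤ d)
    (hP : P ≤ m * (a + d - m)) (hPm : m * P ≤ max a d * (m ^ 2 - (a - m) * (d - m)))
    (hQ : Q ≤ b * c) : P + Q ≤ 2 * k * m := by
  have hbc : b * c ≤ (m + k - a) * (m + k - d) := by
    apply mul_le_mul <;> linarith
  rcases hm.eq_or_lt with rfl | hm
  · have : b = 0 := by linarith
    subst this
    linarith
  refine le_of_mul_le_mul_left ?_ hm
  have key : ∀ s t : ℝ, k - m ≤ s → k - m ≤ t → s ≤ t →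
      (m + t) * (m ^ 2 - s * t) + m * ((k - s) * (k - t)) ≤ m * (2 * k * m) := by
    intro s t hs ht hst
    have hs0 : 0 ≤ s := by linarith
    have ht0 : 0 ≤ t := by linarith
    have : 0 ≤ m * ((k - m) * (t - (k - m))) :=
      mul_nonneg hm.le (mul_nonneg (by linarith) (by linarith))
    have hk : 0 < k := by linarith
    have h2 : 0 ≤ m * (k * s) := by positivity
    have h3 : 0 ≤ s * t ^ 2 := by positivity
    nlinarith
  rcases le_total a d with had | had
  · rw [max_eq_right had] at hPm
    have := key (a - m) (d - m) (by linarith) (by linarith) (by linarith)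
    nlinarith
  · rw [max_eq_left had] at hPm
    have := key (d - m) (a - m) (by linarith) (by linarith) (by linarith)
    nlinarith

/-- The case of `add_le_two_mul_mul_of_staircase_bounds` in which `b` is small and `d` is not. -/
lemma add_le_two_mul_mul_of_le_of_le {m k a b c d P Q : ℝ} (hm : 0 ≤ m) (hmk : m < k)
    (hb : 0 ≤ b) (hc : 0 ≤ c) (hab : a + b ≤ m + k) (hcd : c + d ≤ m + k) (hd : m ≤ d)
    (hbm : b ≤ m) (hP : P ≤ a * d) (hQ : Q ≤ b * c) (hPL : P ≤ m * (a + d - m))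
    (had : a < k ∨ d < k) : P + Q ≤ 2 * k * m := by
  rcases le_total a m with ham | ham
  · nlinarith [mul_le_mul_of_nonneg_right ham (hm.trans hd), mul_le_mul_of_nonneg_right hbm hc,
      mul_le_mul_of_nonneg_left hcd hm]
  rcases le_total m c with hcm | hcm
  · nlinarith [mul_nonneg (sub_nonneg.2 hbm) (sub_nonneg.2 hcm),
      mul_le_mul_of_nonneg_left hab hm, mul_le_mul_of_nonneg_left hcd hm]
  rcases had with h | h
  · nlinarith [mul_le_mul_of_nonneg_left h.le hm, mul_le_mul_of_nonneg_left hcd hm,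
      mul_le_mul_of_nonneg_right hbm hc]
  · nlinarith [mul_le_mul_of_nonneg_left h.le hm, mul_le_mul_of_nonneg_left hab hm,
      mul_le_mul_of_nonneg_left hcm hb]

lemma add_le_two_mul_mul_of_staircase_bounds {m k a b c d P Q : ℝ} (hm : 0 ≤ m) (hmk : m < k)
    (ha : 0 ≤ a) (hb : 0 ≤ b) (hc : 0 ≤ c) (hd : 0 ≤ d)
    (hab : a + b ≤ m + k) (hcd : c + d ≤ m + k)
    (hP : P ≤ a * d) (hQ : Q ≤ b * c)
    (hPL : m ≤ d → P ≤ m * (a + d - m)) (hQL : m ≤ b → Q ≤ m * (b + c - m))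
    (hPm : m * P ≤ max a d * (m ^ 2 - (a - m) * (d - m)))
    (hQm : m * Q ≤ max b c * (m ^ 2 - (b - m) * (c - m))) :
    P + Q ≤ 2 * k * m := by
  by_cases h1 : k ≤ a ∧ k ≤ d
  · exact add_le_two_mul_mul_of_markov_bound hm hmk hb hc hab hcd h1.1 h1.2
      (hPL (by linarith [h1.2])) hPm hQ
  by_cases h2 : k ≤ b ∧ k ≤ c
  · rw [add_comm]
    exact add_le_two_mul_mul_of_markov_bound hm hmk ha hd (by linarith) (by linarith) h2.1 h2.2
      (hQL (by linarith [h2.1])) hQm hP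
  rw [not_and_or, not_le, not_le] at h1 h2
  rcases le_total m d with hdm | hdm <;> rcases le_total m b with hbm | hbm
  · nlinarith [hPL hdm, hQL hbm, mul_le_mul_of_nonneg_left hab hm,
      mul_le_mul_of_nonneg_left hcd hm]
  · exact add_le_two_mul_mul_of_le_of_le hm hmk hb hc hab hcd hdm hbm hP hQ (hPL hdm) h1
  · rw [add_comm]
    have hQ' : Q ≤ c * b := by rwa [mul_comm]
    have hP' : P ≤ d * a := by rwa [mul_comm]
    exact add_le_two_mul_mul_of_le_of_le hm hmk hd ha (by linarith) (by linarith) hbm hdm hQ' hP'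
      (by linarith [hQL hbm]) h2.symm
  · nlinarith [mul_nonneg (sub_nonneg.2 hbm) (sub_nonneg.2 hdm),
      mul_le_mul_of_nonneg_right (show a ≤ m + k - b by linarith) hd,
      mul_le_mul_of_nonneg_left (show c ≤ m + k - d by linarith) hb,
      mul_nonneg (sub_nonneg.2 hmk.le) (show 0 ≤ 2 * m - (b + d) by linarith)]

lemma card_le_add_card_le_le {γ : Type*} [Fintype γ] {m k : ℝ} (hmk : m < k) (f : γ → ℝ) :
    (#{x | k ≤ f x} : ℝ) + #{x | f x ≤ m} ≤ Fintype.card γ := by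
  classical
  have : Disjoint ({x | k ≤ f x} : Finset γ) ({x | f x ≤ m} : Finset γ) :=
    Finset.disjoint_filter.2 fun x _ h1 h2 => by linarith
  rw [← Nat.cast_add, ← Finset.card_union_of_disjoint this]
  exact_mod_cast Finset.card_le_univ _

/-- In a balanced bipartite graph on `n + n` vertices, for `n / 2 < k ≤ n`, at most `2k(n - k)`
pairs of vertices from opposite sides have degrees differing by at least `k`. -/
lemma card_le_abs_degree_sub_le {α β : Type*} [Fintype α] [Fintype β] (E : α → β → Bool) (k : ℝ)
    (hcard : Fintype.card α = Fintype.card β) (hk : k ≤ Fintype.card β)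
    (hk2 : (Fintype.card β : ℝ) < 2 * k) :
    (#{p : α × β | k ≤ |(#{j | E p.1 j} : ℝ) - #{i | E i p.2}|} : ℝ) ≤
      2 * k * (Fintype.card β - k) := by
  classical
  have hcard' : (Fintype.card α : ℝ) = Fintype.card β := by exact_mod_cast hcard
  let F : β → α → Bool := fun j i => E i j
  have hle : (#{p : α × β | k ≤ |(#{j | E p.1 j} : ℝ) - #{i | E i p.2}|} : ℝ) ≤
      #{p : α × β | (#{i | E i p.2} : ℝ) + k ≤ #{j | E p.1 j}} +
      #{p : β × α | (#{j | F j p.2} : ℝ) + k ≤ #{i | F p.1 i}} := by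
    rw [← Finset.card_map (Equiv.prodComm β α).toEmbedding]
    refine le_trans ?_ (Nat.cast_add (R := ℝ) _ _).le
    refine Nat.cast_le.2 (le_trans (Finset.card_le_card fun p hp => ?_)
      (Finset.card_union_le _ _))
    simp only [Finset.mem_filter, Finset.mem_univ, true_and, le_abs] at hp
    rw [Finset.mem_union]
    rcases hp with hp | hp
    · left
      simp only [Finset.mem_filter, Finset.mem_univ, true_and]
      linarith
    · right
      refine Finset.mem_map.2 ⟨p.swap, ?_, by simp⟩
      simp only [F, Finset.mem_filter, Finset.mem_univ, true_and, Prod.fst_swap, Prod.snd_swap]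
      linarith
  refine hle.trans ?_
  have hab := card_le_add_card_le_le (show Fintype.card β - k < k by linarith)
    fun i => (#{j | E i j} : ℝ)
  have hcd := card_le_add_card_le_le (show Fintype.card β - k < k by linarith)
    fun j => (#{i | E i j} : ℝ)
  have hP := card_degree_add_le_le_mul E k
  have hPL := card_degree_add_le_le_of_le_card E k hk
  have hPm := mul_card_degree_add_le_le E k
  have hQ := card_degree_add_le_le_mul F k
  have hQL := card_degree_add_le_le_of_le_card F k (hcard'.symm ▸ hk)
  have hQm := mul_card_degree_add_le_le F k
  rw [hcard'] at hab hQ hQL hQm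
  refine add_le_two_mul_mul_of_staircase_bounds
    (a := #{i | k ≤ (#{j | E i j} : ℝ)})
    (b := #{i | (#{j | E i j} : ℝ) ≤ Fintype.card β - k})
    (c := #{j | k ≤ (#{i | E i j} : ℝ)})
    (d := #{j | (#{i | E i j} : ℝ) ≤ Fintype.card β - k})
    (sub_nonneg.2 hk) (by linarith) (by positivity) (by positivity) (by positivity) (by positivity)
    (by linarith) (by linarith) hP (by rw [mul_comm]; exact hQ) hPL ?_ hPm ?_
  · intro h
    rw [add_comm (#_ : ℝ)]
    exact hQL h
  · rw [max_comm, mul_comm ((#_ : ℝ) - _)]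
    exact hQm

theorem limsup_pair_density_bound (δ : ℝ) (hδ1 : 1 / 2 < δ) (hδ2 : δ ≤ 1)
    (C : ℝ) (hC : 0 ≤ C)
    (E : (n : ℕ) → Fin n → Fin n → Bool)
    (degU degV : (n : ℕ) → Fin n → ℕ)
    (hdegU : ∀ n i, degU n i = (univ.filter (fun j => E n i j)).card)
    (hdegV : ∀ n j, degV n j = (univ.filter (fun i => E n i j)).card) :
    Filter.limsup (fun n : ℕ =>
      (((univ : Finset (Fin n × Fin n)).filter (fun p =>
        (n : ℝ) * δ - 2 * C * (n : ℝ) ^ ((3 : ℝ) / 4)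
          ≤ |(degU n p.1 : ℝ) - (degV n p.2 : ℝ)|)).card : ℝ) / (n : ℝ) ^ 2)
      Filter.atTop ≤ 2 * δ * (1 - δ) := by
  have hpow : Tendsto (fun n : ℕ => (n : ℝ) ^ (-(1 / 4) : ℝ)) atTop (nhds 0) :=
    (tendsto_rpow_neg_atTop (by norm_num)).comp tendsto_natCast_atTop_atTop
  have hdens : Tendsto (fun n : ℕ => δ - 2 * C * (n : ℝ) ^ (-(1 / 4) : ℝ)) atTop (nhds δ) := by
    simpa using tendsto_const_nhds.sub (hpow.const_mul (2 * C))
  have hlim : Tendsto (fun n : ℕ => 2 * (δ - 2 * C * (n : ℝ) ^ (-(1 / 4) : ℝ)) *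
      (1 - (δ - 2 * C * (n : ℝ) ^ (-(1 / 4) : ℝ)))) atTop (nhds (2 * δ * (1 - δ))) :=
    (hdens.const_mul 2).mul (tendsto_const_nhds.sub hdens)
  rw [← hlim.limsup_eq]
  refine Filter.limsup_le_limsup ?_
    (Filter.isCoboundedUnder_le_of_le atTop (x := 0) fun n => by positivity)
    hlim.isBoundedUnder_le
  filter_upwards [hdens.eventually_const_lt hδ1, eventually_gt_atTop 0] with n hn hn0
  have hn0' : (0 : ℝ) < n := by exact_mod_cast hn0
  have hthr : (n : ℝ) * δ - 2 * C * (n : ℝ) ^ ((3 : ℝ) / 4) =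
      n * (δ - 2 * C * (n : ℝ) ^ (-(1 / 4) : ℝ)) := by
    have : (n : ℝ) ^ ((3 : ℝ) / 4) = n * (n : ℝ) ^ (-(1 / 4) : ℝ) := by
      rw [← Real.rpow_one_add' hn0'.le (by norm_num)]
      norm_num
    rw [this]
    ring
  have hle : δ - 2 * C * (n : ℝ) ^ (-(1 / 4) : ℝ) ≤ 1 := by
    have : 0 ≤ 2 * C * (n : ℝ) ^ (-(1 / 4) : ℝ) := by positivity
    linarith
  rw [hthr]
  generalize δ - 2 * C * (n : ℝ) ^ (-(1 / 4) : ℝ) = t at *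
  have h := card_le_abs_degree_sub_le (E n) (n * t) rfl
    (by rw [Fintype.card_fin]; nlinarith) (by rw [Fintype.card_fin]; nlinarith)
  simp only [hdegU, hdegV]
  rw [Fintype.card_fin] at h
  rw [div_le_iff₀ (by positivity)]
  calc _ ≤ _ := h
    _ = _ := by ring
end
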